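/- Let (Δ,Θ) be a directive bi-sequence with associated prefixes (w_n), let n ≥ 0, and suppose Assumption A holds for the pair (w_n, w_{n+1}). Let 0 = p_0 < p_1 < … < p_k = |w_{n+1}| − |w_n| be all positions of occurrences of images of w_n in w_{n+1}. Then the differences p_{m+1} − p_m coincide for all 0 ≤ m ≤ k−1; equivalently, the length of the overlap of any two consecutive occurrences of images of w_n in w_{n+1} is the same. -/

import Mathlib

/-- The ternary alphabet. -/
abbrev Letter := Fin 3

/-- Finite words over the ternary alphabet. -/
abbrev Word := List Letter

/-- The four involutory antimorphisms of ternary words: the reversal `R`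
and, for each letter `i`, the antimorphism `E i`. -/
inductive AM where
  | R : AM
  | E : Letter → AM
deriving DecidableEq

/-- The action of an antimorphism on a single letter: `R` fixes every letter,
and `E i` fixes `i` and exchanges the other two letters (in `Fin 3`,
this involution is `a ↦ -(i + a)`). -/
def AM.letter : AM → Letter → Letter
  | .R, _a => _a
  | .E i, a => -(i + a)

/-- The action of an antimorphism on a word: letterwise image followed by reversal. -/
def AM.apply (t : AM) (w : Word) : Word := (w.map t.letter).reverse

/-- A word is a pseudopalindrome if it is a `ϑ`-palindrome for some
`ϑ ∈ {R, E_0, E_1, E_2}`. -/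
def IsPseudopal (w : Word) : Prop := ∃ t : AM, t.apply w = w

/-- `v` is an image of `w` if `v = ϑ(w)` for some `ϑ ∈ {R, E_0, E_1, E_2}`. -/
def IsImage (w v : Word) : Prop := ∃ t : AM, v = t.apply w

/-- `v` is the `ϑ`-palindromic closure of `u`: the shortest `ϑ`-palindrome
having `u` as a prefix. -/
def IsPalClosure (t : AM) (u v : Word) : Prop :=
  u <+: v ∧ t.apply v = v ∧
    ∀ v' : Word, u <+: v' → t.apply v' = v' → v.length ≤ v'.length

/-- `w` is the sequence of prefixes associated with the directive bi-sequence
`(Δ, Θ)`: `w 0 = ε` and `w (n+1) = (w n · δ_{n+1})^{ϑ_{n+1}}`. -/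
def DirectivePrefixes (Δ : ℕ → Letter) (Θ : ℕ → AM) (w : ℕ → Word) : Prop :=
  w 0 = [] ∧ ∀ n : ℕ, IsPalClosure (Θ (n + 1)) (w n ++ [Δ (n + 1)]) (w (n + 1))

/-- A pseudopalindromic prefix `v` of `w_{n+1}` is missed between `w_n` and `w_{n+1}`
if `|w_n| < |v| < |w_{n+1}|`. -/
def MissedBetween (wn wn1 v : Word) : Prop :=
  v <+: wn1 ∧ IsPseudopal v ∧ wn.length < v.length ∧ v.length < wn1.length

/-- An image of `u` occurs in `v` at (0-indexed) position `p`. -/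
def OccursImageAt (u v : Word) (p : ℕ) : Prop :=
  p + u.length ≤ v.length ∧ IsImage u ((v.drop p).take u.length)

/-- Assumption A for the pair `(wn, wn1)`: some image of `wn` occurs in `wn1`
at a position `p` with `0 < p < |wn1| - |wn|`, overlapping both the prefix
occurrence of `wn` and the suffix occurrence of an image of `wn`. -/
def AssumptionA (wn wn1 : Word) : Prop :=
  ∃ p : ℕ, 0 < p ∧ p < wn1.length - wn.length ∧ p < wn.length ∧
    wn1.length - wn.length < p + wn.length ∧ OccursImageAt wn wn1 p

/-- The prefix of length `n` of the directive bi-sequence is normalized: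
every pseudopalindromic prefix of `w n` equals `w k` for some `k ≤ n`. -/
def NormalizedUpTo (w : ℕ → Word) (n : ℕ) : Prop :=
  ∀ v : Word, v <+: w n → IsPseudopal v → ∃ k : ℕ, k ≤ n ∧ v = w k

/-- `rep u l` is the `l`-fold concatenation `u^l`. -/
def rep (u : Word) (l : ℕ) : Word := (List.replicate l u).flatten

/-- `rmSuf x y` is `x · y⁻¹`: the word `x` with its suffix of length `|y|` removed. -/
def rmSuf (x y : Word) : Word := x.take (x.length - y.length)

/-- `v` is a prefix of the infinite periodic word `pat^ω`. -/
def IsPrefixOfPow (pat v : Word) : Prop :=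
  ∀ q : ℕ, ∀ hq : q < v.length, ∃ hp : q % pat.length < pat.length,
    v.get ⟨q, hq⟩ = pat.get ⟨q % pat.length, hp⟩

/-- The permutation of the alphabet underlying an antimorphism. -/
def AM.perm (t : AM) : Equiv.Perm Letter :=
  Function.Involutive.toPerm t.letter (by
    intro a
    cases t with
    | R => rfl
    | E i => simp [AM.letter])

theorem AM.perm_mul_self (t : AM) : t.perm * t.perm = 1 := by
  ext1 a
  exact t.perm.left_inv a

theorem AM.perm_apply_perm (t : AM) (a : Letter) : t.perm (t.perm a) = a :=
  t.perm.left_inv a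

theorem exists_perm_eq_of_mul_self (π : Equiv.Perm Letter) (h : π * π = 1) :
    ∃ t : AM, t.perm = π := by
  have key : ∀ π : Equiv.Perm (Fin 3), π * π = 1 →
      AM.R.perm = π ∨ ∃ i, (AM.E i).perm = π := by decide
  rcases key π h with h | ⟨i, h⟩
  exacts [⟨_, h⟩, ⟨_, h⟩]

/-- A permutation of three letters whose square fixes a letter is an involution. -/
theorem mul_self_of_apply_apply : ∀ (π : Equiv.Perm Letter) (a : Letter),
    π (π a) = a → π * π = 1 := by decide

/-- A permutation of three letters is determined by two of its values. -/
theorem perm_eq_of_agree : ∀ (π ρ : Equiv.Perm Letter) (a b : Letter),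
    a ≠ b → π a = ρ a → π b = ρ b → π = ρ := by decide

/-- The factor of `v` of length `m` at position `a` is fixed by the antimorphism with
letter map `t`. -/
def SymmOn (v : ℕ → Letter) (t : Equiv.Perm Letter) (a m : ℕ) : Prop :=
  ∀ i j, i + j + 1 = m → v (a + i) = t (v (a + j))

/-- A letterwise permuted copy of the prefix of length `L` of `v` occurs at position `q`. -/
def PermOcc (v : ℕ → Letter) (L q : ℕ) : Prop :=
  ∃ π : Equiv.Perm Letter, ∀ j < L, v (q + j) = π (v j)

/-- A copy of the prefix of length `L` of `v`, permuted by `t * θ` with `t` an involution,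
occurs at position `q`. -/
def InvolOcc (v : ℕ → Letter) (θ : Equiv.Perm Letter) (L q : ℕ) : Prop :=
  ∃ t : Equiv.Perm Letter, t * t = 1 ∧ ∀ j < L, v (q + j) = t (θ (v j))

theorem InvolOcc.permOcc {v : ℕ → Letter} {θ : Equiv.Perm Letter} {L q : ℕ}
    (h : InvolOcc v θ L q) : PermOcc v L q := by
  obtain ⟨t, -, h⟩ := h
  exact ⟨t * θ, h⟩

theorem permOcc_zero (v : ℕ → Letter) (L : ℕ) : PermOcc v L 0 :=
  ⟨1, fun j _ => by simp⟩

/-- Two overlapping permuted copies of a pseudopalindrome span a pseudopalindrome. -/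
theorem exists_symmOn_of_overlap {v : ℕ → Letter} {θ : Equiv.Perm Letter} {L : ℕ}
    (hθ : SymmOn v θ 0 L) {a c : ℕ} (hc : c < L)
    (ha : PermOcc v L a) (hb : PermOcc v L (a + c)) :
    ∃ t : Equiv.Perm Letter, t * t = 1 ∧ SymmOn v t a (c + L) := by
  obtain ⟨π, hπ⟩ := ha
  obtain ⟨ρ, hρ⟩ := hb
  obtain ⟨t, ht⟩ : ∃ t : Equiv.Perm Letter, t = ρ * θ * π⁻¹ := ⟨_, rfl⟩
  have main : ∀ i j, i + j + 1 = c + L → j < L → v (a + i) = t (v (a + j)) := by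
    intro i j hij hj
    obtain ⟨k, rfl⟩ : ∃ k, i = c + k := ⟨i - c, by omega⟩
    have h1 := hρ k (by omega)
    have h2 := hθ k j (by omega)
    simp only [zero_add] at h2
    rw [hπ j hj, ← add_assoc, h1, h2, ht]
    simp
  have hinv : t * t = 1 := by
    have h1 := main c (L - 1) (by omega) (by omega)
    have h2 := main (L - 1) c (by omega) hc
    exact mul_self_of_apply_apply t _ (by rw [← h2, ← h1])
  refine ⟨t, hinv, fun i j hij => ?_⟩
  by_cases hj : j < L
  · exact main i j hij hj
  · rw [main j i (by omega) (by omega), ← Equiv.Perm.mul_apply, hinv]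
    rfl

theorem PermOcc.involOcc {v : ℕ → Letter} {θ : Equiv.Perm Letter} {L : ℕ}
    (hθ : SymmOn v θ 0 L) {q : ℕ} (hq : q < L) (h : PermOcc v L q) :
    InvolOcc v θ L q := by
  obtain ⟨t, ht, hs⟩ := exists_symmOn_of_overlap hθ (a := 0) hq (permOcc_zero v L)
    (by simpa using h)
  refine ⟨t, ht, fun j hj => ?_⟩
  have h1 := hs (q + j) (L - 1 - j) (by omega)
  have h2 := hθ (L - 1 - j) j (by omega)
  simp only [zero_add] at h1 h2
  rw [h1, h2]

/-- Reflection in a pseudopalindromic factor preserves permuted occurrences. -/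
theorem PermOcc.reflect {v : ℕ → Letter} {θ t : Equiv.Perm Letter} {L : ℕ}
    (hθ : SymmOn v θ 0 L) {a x y : ℕ} (hs : SymmOn v t a (x + y + L))
    (h : PermOcc v L (a + x)) : PermOcc v L (a + y) := by
  obtain ⟨π, hπ⟩ := h
  refine ⟨t * π * θ, fun j hj => ?_⟩
  have h1 := hs (y + j) (x + (L - 1 - j)) (by omega)
  have h2 := hθ (L - 1 - j) j (by omega)
  have h3 := hπ (L - 1 - j) (by omega)
  simp only [zero_add] at h2
  rw [add_assoc, h1, ← add_assoc, h3, h2]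
  simp

/-- If `S ⊆ [0, d]` is symmetric in `[0, d]` and closed under reflections in pairs of elements
at distance less than `L`, and some `p ∈ S` splits `[0, d]` into two nonempty parts shorter
than `L`, then `S` is an arithmetic progression. -/
theorem exists_step_of_locally_symmetric {S : ℕ → Prop} {d p L : ℕ}
    (hS0 : S 0) (hSd : S d) (hSp : S p) (hp0 : 0 < p) (hpd : p < d) (hpL : p < L)
    (hdL : d < p + L)
    (hglob : ∀ x y, x + y = d → S x → S y)
    (hloc : ∀ a x y, x + y < L → S a → S (a + x + y) → S (a + x) → S (a + y)) :
    ∃ g, 0 < g ∧ S g ∧ g ∣ p ∧ g ∣ d ∧ ∀ q ≤ d, S q ↔ g ∣ q := by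
  classical
  have hex : ∃ x, 0 < x ∧ S x := ⟨p, hp0, hSp⟩
  obtain ⟨g, ⟨hg0, hSg⟩, hmin⟩ : ∃ g, (0 < g ∧ S g) ∧ ∀ x, 0 < x → S x → g ≤ x :=
    ⟨Nat.find hex, Nat.find_spec hex, fun x h1 h2 => Nat.find_min' hex ⟨h1, h2⟩⟩
  have hgp := hmin p hp0 hSp
  have down : ∀ x, g + x ≤ p → S (g + x) → S x := by
    intro x hx h
    have := hloc 0 g x (by omega) hS0 (by simpa using h) (by simpa using hSg)
    simpa using this
  have up : ∀ x, p ≤ x → x < d → S x → x + g ≤ d ∧ S (x + g) := by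
    intro x hpx hxd h
    have h1 := hmin (d - x) (by omega) (hglob x (d - x) (by omega) h)
    refine ⟨by omega, ?_⟩
    have hdg : S (x + (d - g - x)) := by
      rw [show x + (d - g - x) = d - g by omega]
      exact hglob g (d - g) (by omega) hSg
    refine hloc x (d - g - x) g (by omega) h ?_ hdg
    rwa [show x + (d - g - x) + g = d by omega]
  have left_dvd : ∀ x, x ≤ p → S x → g ∣ x := by
    intro x
    induction x using Nat.strong_induction_on with
    | _ x ih =>
      intro hx h
      rcases Nat.eq_zero_or_pos x with rfl | h0
      · exact dvd_zero g
      · obtain ⟨y, rfl⟩ := Nat.exists_eq_add_of_le (hmin x h0 h)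
        exact (Nat.dvd_add_right (dvd_refl g)).2
          (ih y (by omega) (by omega) (down y hx h))
  have right_dvd : ∀ y x, x + y = d → p ≤ x → S x → g ∣ y := by
    intro y
    induction y using Nat.strong_induction_on with
    | _ y ih =>
      intro x hxy hx h
      rcases Nat.eq_zero_or_pos y with rfl | h0
      · exact dvd_zero g
      · obtain ⟨h1, h2⟩ := up x hx (by omega) h
        obtain ⟨z, rfl⟩ := Nat.exists_eq_add_of_le (show g ≤ y by omega)
        exact (Nat.dvd_add_right (dvd_refl g)).2
          (ih z (by omega) (x + g) (by omega) (by omega) h2)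
  have hdp : g ∣ p := left_dvd p le_rfl hSp
  have hdd : g ∣ d := by
    have := dvd_add hdp (right_dvd (d - p) p (by omega) le_rfl hSp)
    rwa [show p + (d - p) = d by omega] at this
  have left_mem : ∀ c x, x + g * c = p → S x := by
    intro c
    induction c with
    | zero => intro x hx; obtain rfl : x = p := by simpa using hx
              exact hSp
    | succ c ih =>
      intro x hx
      rw [Nat.mul_succ] at hx
      exact down x (by omega) (ih (g + x) (by omega))
  have right_mem : ∀ c, p + g * c ≤ d → S (p + g * c) := by
    intro c
    induction c with
    | zero => intro _; simpa using hSp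
    | succ c ih =>
      intro hx
      rw [Nat.mul_succ] at hx ⊢
      rw [← add_assoc]
      exact (up (p + g * c) (by omega) (by omega) (ih (by omega))).2
  refine ⟨g, hg0, hSg, hdp, hdd, fun q hq => ⟨fun h => ?_, fun h => ?_⟩⟩
  · rcases le_total q p with hqp | hqp
    · exact left_dvd q hqp h
    · have h1 := right_dvd (d - q) q (by omega) hqp h
      refine (Nat.dvd_add_right h1).1 ?_
      rwa [show d - q + q = d by omega]
  · rcases le_total q p with hqp | hqp
    · obtain ⟨c, hc⟩ := Nat.dvd_sub hdp h
      exact left_mem c q (by omega)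
    · obtain ⟨c, hc⟩ := Nat.dvd_sub h hdp
      have := right_mem c (by omega)
      rwa [show p + g * c = q by omega] at this

/-- A word of length `L + g` with shift by `g` realized by `τ`, whose prefix of length `L > 2 * g`
has shift by `g` realized by `σ`, has shift by `g` realized by `σ` throughout. -/
theorem periodic_extend {y : ℕ → Letter} {σ τ : Equiv.Perm Letter} {g L : ℕ}
    (hg : 2 * g < L) (h₁ : ∀ j, j + g < L → y (j + g) = σ (y j))
    (h₂ : ∀ j < L, y (j + g) = τ (y j)) : ∀ j < L, y (j + g) = σ (y j) := by
  by_cases hc : ∃ i j, i + g < L ∧ j + g < L ∧ y i ≠ y j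
  · obtain ⟨i, j, hi, hj, hne⟩ := hc
    have : σ = τ := perm_eq_of_agree σ τ _ _ hne
      (by rw [← h₁ i hi, h₂ i (by omega)]) (by rw [← h₁ j hj, h₂ j (by omega)])
    rwa [this]
  · push Not at hc
    have hconst : ∀ j < L, y j = y 0 := by
      intro j hj
      by_cases hjg : j + g < L
      · exact hc j 0 hjg (by omega)
      · have e1 := h₁ (j - g) (by omega)
        have e2 := h₁ 0 (by omega)
        rw [show j - g + g = j by omega, hc (j - g) 0 (by omega) (by omega), ← e2] at e1
        rw [e1]
        exact hc _ 0 (by omega) (by omega)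
    intro j hj
    have e1 := h₂ 0 (by omega)
    rw [h₂ j hj, hconst j hj, ← e1]
    exact h₁ 0 (by omega)

/-- If permuted copies of the prefix of length `L` occur at all multiples of `g` up to `d`
and `2 * g < L`, then all these copies come from involutive antimorphisms. -/
theorem involOcc_mul_of_permOcc {v : ℕ → Letter} {θ : Equiv.Perm Letter} {L d g : ℕ}
    (hθ : SymmOn v θ 0 L) (hθθ : θ * θ = 1) (hg : 2 * g < L)
    (h : ∀ a, a * g ≤ d → PermOcc v L (a * g)) (hS : PermOcc v L g) :
    ∀ a, a * g ≤ d → InvolOcc v θ L (a * g) := by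
  obtain ⟨t, ht, hσ⟩ := hS.involOcc hθ (by omega)
  have periodic : ∀ a, a * g ≤ d → ∀ j, j + g < a * g + L → v (j + g) = (t * θ) (v j) := by
    intro a
    induction a with
    | zero =>
      intro _ j hj
      rw [add_comm, hσ j (by omega)]
      rfl
    | succ a ih =>
      intro ha j hj
      rw [Nat.succ_mul] at ha hj
      by_cases hja : j + g < a * g + L
      · exact ih (by omega) j hja
      obtain ⟨π, hπ⟩ := h a (by omega)
      obtain ⟨ρ, hρ⟩ := h (a + 1) (by rw [Nat.succ_mul]; omega)
      have := periodic_extend (y := fun i => v (a * g + i)) (σ := t * θ) (τ := ρ * π⁻¹) hg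
        (fun i hi => by simpa only [add_assoc] using ih (by omega) (a * g + i) (by omega))
        (fun i hi => by
          have e := hρ i hi
          rw [Nat.succ_mul] at e
          rw [hπ i hi, show a * g + (i + g) = a * g + g + i by omega, e]
          simp)
        (j - a * g) (by omega)
      rwa [show a * g + (j - a * g + g) = j + g by omega,
        show a * g + (j - a * g) = j by omega] at this
  intro a ha
  have copies : ∀ b, b * g ≤ d → ∀ j < L, v (b * g + j) = ((t * θ) ^ b) (v j) := by
    intro b
    induction b with
    | zero => intro _ j _; simp
    | succ b ih =>
      intro hb j hj
      have e := periodic (b + 1) hb (b * g + j) (by rw [Nat.succ_mul]; omega)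
      rw [Nat.succ_mul] at hb ⊢
      rw [show b * g + g + j = b * g + j + g by omega, e, ih (by omega) j hj, pow_succ',
        Equiv.Perm.mul_apply (t * θ) ((t * θ) ^ b)]
  have dihedral : ∀ b : ℕ, (t * θ) ^ b * θ * (t * θ) ^ b = θ := by
    intro b
    induction b with
    | zero => simp
    | succ b ih =>
      calc (t * θ) ^ (b + 1) * θ * (t * θ) ^ (b + 1)
          = (t * θ) * ((t * θ) ^ b * θ * (t * θ) ^ b) * (t * θ) := by
            nth_rw 1 [pow_succ']
            rw [pow_succ]
            simp only [mul_assoc]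
        _ = t * (θ * θ) * (t * θ) := by rw [ih]; simp only [mul_assoc]
        _ = (t * t) * θ := by rw [hθθ]; simp only [mul_assoc, one_mul]
        _ = θ := by rw [ht, one_mul]
  refine ⟨(t * θ) ^ a * θ, ?_, fun j hj => ?_⟩
  · rw [← mul_assoc, dihedral, hθθ]
  · rw [copies a ha j hj, ← Equiv.Perm.mul_apply _ θ, mul_assoc, hθθ, mul_one]

theorem exists_step_involOcc {v : ℕ → Letter} {θ τ : Equiv.Perm Letter} {L d p : ℕ}
    (hθ : SymmOn v θ 0 L) (hθθ : θ * θ = 1) (hτ : SymmOn v τ 0 (d + L))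
    (h0 : InvolOcc v θ L 0) (hd : InvolOcc v θ L d) (hp : InvolOcc v θ L p)
    (hp0 : 0 < p) (hpd : p < d) (hpL : p < L) (hdL : d < p + L) :
    ∃ g, 0 < g ∧ ∀ q ≤ d, InvolOcc v θ L q ↔ g ∣ q := by
  obtain ⟨g, hg0, hSg, hgp, hgd, hiff⟩ := exists_step_of_locally_symmetric
    (S := PermOcc v L) h0.permOcc hd.permOcc hp.permOcc hp0 hpd hpL hdL
    (fun x y hxy hx => by
      have := PermOcc.reflect hθ (a := 0) (x := x) (y := y) (by rwa [hxy]) (by simpa using hx)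
      simpa using this)
    (fun a x y hxy ha hb hx => by
      obtain ⟨t, -, ht⟩ := exists_symmOn_of_overlap hθ hxy ha (by rwa [← add_assoc])
      exact PermOcc.reflect hθ ht hx)
  refine ⟨g, hg0, fun q hq => ⟨fun h => (hiff q hq).1 h.permOcc, fun h => ?_⟩⟩
  rcases lt_or_ge (2 * g) L with hgL | hgL
  · obtain ⟨a, rfl⟩ := h
    rw [mul_comm] at hq ⊢
    exact involOcc_mul_of_permOcc hθ hθθ hgL
      (fun b hb => (hiff _ hb).2 (dvd_mul_left g b)) hSg a hq
  · obtain ⟨a, rfl⟩ := h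
    obtain ⟨b, rfl⟩ := hgp
    obtain ⟨c, rfl⟩ := hgd
    have hb : b = 1 := by
      have h1 : 0 < b := Nat.pos_of_mul_pos_left hp0
      have h2 : b < 2 := by
        by_contra hcon
        have := Nat.mul_le_mul_left g (not_lt.1 hcon)
        omega
      omega
    subst hb
    have hc : c < 3 := by
      by_contra hcon
      have := Nat.mul_le_mul_left g (not_lt.1 hcon)
      omega
    have hc1 : 1 < c := lt_of_mul_lt_mul_left hpd (Nat.zero_le g)
    obtain rfl : c = 2 := by omega
    have ha : a ≤ 2 := Nat.le_of_mul_le_mul_left hq hg0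
    interval_cases a
    · simpa using h0
    · exact hp
    · exact hd

theorem AM.length_apply (t : AM) (u : Word) : (t.apply u).length = u.length := by
  simp [AM.apply]

theorem AM.getD_apply (t : AM) (u : Word) {i j : ℕ} (h : i + j + 1 = u.length) :
    (t.apply u).getD i 0 = t.perm (u.getD j 0) := by
  have hi : i < (t.apply u).length := by rw [t.length_apply]; omega
  have hj : j < u.length := by omega
  rw [List.getD_eq_getElem _ _ hi, List.getD_eq_getElem _ _ hj]
  have : u.length - 1 - i = j := by omega
  simp only [AM.apply, List.getElem_reverse, List.getElem_map, List.length_map, this]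
  rfl

theorem symmOn_of_apply_eq {t : AM} {u v : Word} (h : t.apply u = u) (huv : u <+: v) :
    SymmOn (fun i => v.getD i 0) t.perm 0 u.length := by
  obtain ⟨s, rfl⟩ := huv
  intro i j hij
  have := t.getD_apply u hij
  rw [h] at this
  simp only [zero_add]
  rw [List.getD_append _ _ _ _ (by omega), List.getD_append _ _ _ _ (by omega), this]

theorem occursImageAt_iff_involOcc {t : AM} {u v : Word} (h : t.apply u = u) (huv : u <+: v)
    {q : ℕ} (hq : q + u.length ≤ v.length) :
    OccursImageAt u v q ↔ InvolOcc (fun i => v.getD i 0) t.perm u.length q := by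
  have hlen : ((v.drop q).take u.length).length = u.length := by
    simp only [List.length_take, List.length_drop]; omega
  have hget : ∀ j < u.length, ((v.drop q).take u.length).getD j 0 = v.getD (q + j) 0 := by
    intro j hj
    rw [List.getD_eq_getElem _ _ (by omega), List.getD_eq_getElem _ _ (by omega)]
    simp
  have hpre : ∀ j < u.length, v.getD j 0 = u.getD j 0 := by
    obtain ⟨s, rfl⟩ := huv
    intro j hj
    exact List.getD_append _ _ _ _ hj
  have himage : ∀ (r : AM), ∀ j < u.length,
      (r.apply u).getD j 0 = r.perm (t.perm (v.getD j 0)) := by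
    intro r j hj
    have h1 := t.getD_apply u (i := u.length - 1 - j) (j := j) (by omega)
    rw [h] at h1
    rw [r.getD_apply u (j := u.length - 1 - j) (by omega), h1, hpre j hj]
  constructor
  · rintro ⟨-, r, hr⟩
    refine ⟨r.perm, r.perm_mul_self, fun j hj => ?_⟩
    dsimp only
    rw [← hget j hj, hr, himage r j hj]
  · rintro ⟨π, hπ, hocc⟩
    obtain ⟨r, rfl⟩ := exists_perm_eq_of_mul_self π hπ
    refine ⟨hq, r, List.ext_getElem (by rw [hlen, r.length_apply]) fun j h1 h2 => ?_⟩
    rw [← List.getD_eq_getElem _ 0 h1, ← List.getD_eq_getElem _ 0 h2, hget j (by omega),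
      himage r j (by omega)]
    exact hocc j (by omega)

/-- A strictly increasing enumeration of the multiples of `g` up to `d` has all its
steps equal to `g`. -/
theorem succ_sub_castSucc_of_range {g d k : ℕ} (hg : 0 < g)
    {ps : Fin (k + 1) → ℕ} (hmono : StrictMono ps)
    (hrange : ∀ q, (∃ m, ps m = q) ↔ q ≤ d ∧ g ∣ q) (m : Fin k) :
    ps m.succ - ps m.castSucc = g := by
  have hlt : ps m.castSucc < ps m.succ := hmono (Fin.castSucc_lt_succ)
  obtain ⟨-, ha⟩ := (hrange _).1 ⟨m.castSucc, rfl⟩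
  obtain ⟨hbd, hb⟩ := (hrange _).1 ⟨m.succ, rfl⟩
  have hle : g ≤ ps m.succ - ps m.castSucc :=
    Nat.le_of_dvd (by omega) (Nat.dvd_sub hb ha)
  obtain ⟨l, hl⟩ := (hrange (ps m.castSucc + g)).2 ⟨by omega, dvd_add ha (dvd_refl g)⟩
  have h1 : m.castSucc < l := hmono.lt_iff_lt.1 (by omega)
  have h2 : ps m.succ ≤ ps l := hmono.monotone (Fin.castSucc_lt_iff_succ_le.1 h1)
  omega

/-- Lemma (stairs): under Assumption A, consecutive occurrences of images of `w n`
in `w (n+1)` are equally spaced. -/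
theorem equal_overlaps_of_consecutive_images
    (Δ : ℕ → Letter) (Θ : ℕ → AM) (w : ℕ → Word)
    (hw : DirectivePrefixes Δ Θ w) (n : ℕ)
    (hA : AssumptionA (w n) (w (n + 1)))
    (k : ℕ) (ps : Fin (k + 1) → ℕ) (hmono : StrictMono ps)
    (h0 : ps 0 = 0)
    (hlast : ps (Fin.last k) = (w (n + 1)).length - (w n).length)
    (hall : ∀ q : ℕ,
      OccursImageAt (w n) (w (n + 1)) q ↔ ∃ m : Fin (k + 1), ps m = q) :
    ∀ m m' : Fin k,
      ps m.succ - ps m.castSucc = ps m'.succ - ps m'.castSucc := by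
  obtain ⟨p, hp0, hpd, hpL, hdL, hp⟩ := hA
  obtain ⟨n, rfl⟩ : ∃ l, n = l + 1 := by
    cases n with
    | zero => rw [hw.1] at hpL; simp at hpL
    | succ l => exact ⟨l, rfl⟩
  obtain ⟨-, hu, -⟩ := hw.2 n
  obtain ⟨hpre, hv, -⟩ := hw.2 (n + 1)
  have huv : w (n + 1) <+: w (n + 1 + 1) := (List.prefix_append _ _).trans hpre
  have hlen := huv.length_le
  have hτ := symmOn_of_apply_eq hv (List.prefix_refl _)
  rw [show (w (n + 1 + 1)).length
    = (w (n + 1 + 1)).length - (w (n + 1)).length + (w (n + 1)).length by omega] at hτ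
  have conv : ∀ q ≤ (w (n + 1 + 1)).length - (w (n + 1)).length, _ := fun q hq =>
    occursImageAt_iff_involOcc hu huv (q := q) (by omega)
  obtain ⟨g, hg0, hg⟩ := exists_step_involOcc (symmOn_of_apply_eq hu huv)
    (AM.perm_mul_self _) hτ ((conv 0 (Nat.zero_le _)).1 ((hall 0).2 ⟨0, h0⟩))
    ((conv _ le_rfl).1 ((hall _).2 ⟨Fin.last k, hlast⟩)) ((conv p hpd.le).1 hp)
    hp0 hpd hpL (by omega)
  have hrange : ∀ q, (∃ m, ps m = q) ↔
      q ≤ (w (n + 1 + 1)).length - (w (n + 1)).length ∧ g ∣ q := by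
    intro q
    rw [← hall q]
    constructor
    · intro h
      have hq : q ≤ (w (n + 1 + 1)).length - (w (n + 1)).length := by
        have := h.1
        omega
      exact ⟨hq, (hg q hq).1 ((conv q hq).1 h)⟩
    · rintro ⟨hq, h⟩
      exact (conv q hq).2 ((hg q hq).2 h)
  intro m m'
  rw [succ_sub_castSucc_of_range hg0 hmono hrange,
    succ_sub_castSucc_of_range hg0 hmono hrange]
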